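/- arXiv:1401.2565 — 5 statements merged into one kernel-verified Lean document; each statement's English description precedes it below -/
import Mathlib

section
/- Let n ≥ 4 be an integer, a a real number with 0 < a < 1, and let U = {x ∈ ℝⁿ : x₁ > 0 and −π/2 < x_{n−1} < π/2} (a convex open set). Suppose L, ξ : U → ℝ^{n+1} are smooth maps satisfying the system: (i) ∂²L/∂x_i∂x_j = 0 for all 1 ≤ i, j ≤ n−2; (ii) ∂²L/∂x₁∂x_r = (1/x₁)∂L/∂x_r for r ∈ {n−1, n}; (iii) ∂²L/∂x_k∂x_r = 0 for 2 ≤ k ≤ n−2 and r ∈ {n−1, n}; (iv) ∂²L/∂x_{n−1}² = −a²x₁ ∂L/∂x₁ + a√(1−a²)x₁ ξ; (v) ∂²L/∂x_{n−1}∂x_n = −tan(x_{n−1}) ∂L/∂x_n; (vi) ∂²L/∂x_n² = −a²x₁cos²(x_{n−1}) ∂L/∂x₁ + (sin(2x_{n−1})/2) ∂L/∂x_{n−1} + a√(1−a²)x₁cos²(x_{n−1}) ξ; (vii) ∂ξ/∂x_j = 0 for 1 ≤ j ≤ n−2; (viii) ∂ξ/∂x_r = −(√(1−a²)/(a x₁))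 ∂L/∂x_r for r ∈ {n−1, n}. Then there exist constant vectors c₀, c₁, …, c_{n+1} ∈ ℝ^{n+1} such that for all x ∈ U, L(x) = c₀ + Σ_{α=1}^{n−2} c_α x_α + x₁(c_{n−1} sin x_{n−1} + c_n cos x_{n−1} sin x_n + c_{n+1} cos x_{n−1} cos x_n). -/
open Real

/-- Partial derivative of `L` at `x` in the direction of the `i`-th standard basis vector,
in the sense of the Fréchet derivative. -/
noncomputable def pd {n : ℕ} {F : Type*} [NormedAddCommGroup F] [NormedSpace ℝ F]
    (L : EuclideanSpace ℝ (Fin n) → F) (x : EuclideanSpace ℝ (Fin n)) (i : Fin n) : F :=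
  fderiv ℝ L x (EuclideanSpace.single i 1)

/-- Second partial derivative of `L` at `x` in the directions of the `i`-th and `j`-th
standard basis vectors. -/
noncomputable def pd2 {n : ℕ} {F : Type*} [NormedAddCommGroup F] [NormedSpace ℝ F]
    (L : EuclideanSpace ℝ (Fin n) → F) (x : EuclideanSpace ℝ (Fin n)) (i j : Fin n) : F :=
  pd (fun y => pd L y i) x j

section PartialDerivatives

variable {n : ℕ} {F : Type*} [NormedAddCommGroup F] [NormedSpace ℝ F]
  {x : EuclideanSpace ℝ (Fin n)} {U : Set (EuclideanSpace ℝ (Fin n))}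

theorem differentiableAt_coord (x : EuclideanSpace ℝ (Fin n)) (j : Fin n) :
    DifferentiableAt ℝ (fun y : EuclideanSpace ℝ (Fin n) => y j) x :=
  (EuclideanSpace.proj (𝕜 := ℝ) j).differentiableAt

theorem pd_coord (x : EuclideanSpace ℝ (Fin n)) (i j : Fin n) :
    pd (fun y : EuclideanSpace ℝ (Fin n) => y j) x i = if j = i then 1 else 0 := by
  have h : HasFDerivAt (fun y : EuclideanSpace ℝ (Fin n) => y j)
      (EuclideanSpace.proj (𝕜 := ℝ) j) x := (EuclideanSpace.proj (𝕜 := ℝ) j).hasFDerivAt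
  simp [pd, h.fderiv]

theorem pd_comp_coord {φ : ℝ → ℝ} {φ' : ℝ} {j : Fin n} (hφ : HasDerivAt φ φ' (x j))
    (i : Fin n) :
    pd (fun y : EuclideanSpace ℝ (Fin n) => φ (y j)) x i = if j = i then φ' else 0 := by
  have h := hφ.comp_hasFDerivAt x (differentiableAt_coord x j).hasFDerivAt
  have h' := pd_coord x i j
  rw [pd] at h' ⊢
  rw [show (fun y : EuclideanSpace ℝ (Fin n) => φ (y j)) = φ ∘ fun y => y j from rfl, h.fderiv]
  simp [h']

theorem pd_add {f g : EuclideanSpace ℝ (Fin n) → F} (hf : DifferentiableAt ℝ f x)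
    (hg : DifferentiableAt ℝ g x) (i : Fin n) :
    pd (fun y => f y + g y) x i = pd f x i + pd g x i := by
  simp [pd, fderiv_fun_add hf hg]

theorem pd_sub {f g : EuclideanSpace ℝ (Fin n) → F} (hf : DifferentiableAt ℝ f x)
    (hg : DifferentiableAt ℝ g x) (i : Fin n) :
    pd (fun y => f y - g y) x i = pd f x i - pd g x i := by
  simp [pd, fderiv_fun_sub hf hg]

theorem pd_sum {ι : Type*} {s : Finset ι} {f : ι → EuclideanSpace ℝ (Fin n) → F}
    (hf : ∀ k ∈ s, DifferentiableAt ℝ (f k) x) (i : Fin n) :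
    pd (fun y => ∑ k ∈ s, f k y) x i = ∑ k ∈ s, pd (f k) x i := by
  simp [pd, fderiv_fun_sum hf]

theorem pd_smul {f : EuclideanSpace ℝ (Fin n) → ℝ} {g : EuclideanSpace ℝ (Fin n) → F}
    (hf : DifferentiableAt ℝ f x) (hg : DifferentiableAt ℝ g x) (i : Fin n) :
    pd (fun y => f y • g y) x i = f x • pd g x i + pd f x i • g x := by
  simp [pd, fderiv_fun_smul hf hg]

theorem pd_const_smul {g : EuclideanSpace ℝ (Fin n) → F} (c : ℝ)
    (hg : DifferentiableAt ℝ g x) (i : Fin n) :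
    pd (fun y => c • g y) x i = c • pd g x i := by
  simp [pd, fderiv_fun_const_smul hg]

theorem pd_smul_const {f : EuclideanSpace ℝ (Fin n) → ℝ} (hf : DifferentiableAt ℝ f x)
    (c : F) (i : Fin n) :
    pd (fun y => f y • c) x i = pd f x i • c := by
  simp [pd, fderiv_smul_const hf]

theorem pd_comp_coord_smul {φ : ℝ → ℝ} {φ' : ℝ} {j : Fin n}
    {g : EuclideanSpace ℝ (Fin n) → F} (hφ : HasDerivAt φ φ' (x j))
    (hg : DifferentiableAt ℝ g x) (i : Fin n) :
    pd (fun y => φ (y j) • g y) x i = φ (x j) • pd g x i + (if j = i then φ' else 0) • g x := by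
  rw [← pd_comp_coord hφ i]
  exact pd_smul (hφ.differentiableAt.comp x (differentiableAt_coord x j)) hg i

theorem differentiableAt_comp_coord_smul {φ : ℝ → ℝ} {φ' : ℝ} {j : Fin n}
    {g : EuclideanSpace ℝ (Fin n) → F} (hφ : HasDerivAt φ φ' (x j))
    (hg : DifferentiableAt ℝ g x) : DifferentiableAt ℝ (fun y => φ (y j) • g y) x :=
  (hφ.differentiableAt.comp x (differentiableAt_coord x j)).smul hg

theorem contDiffOn_pd {f : EuclideanSpace ℝ (Fin n) → F} (hU : IsOpen U)
    (hf : ContDiffOn ℝ (⊤ : ℕ∞) f U) (i : Fin n) :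
    ContDiffOn ℝ (⊤ : ℕ∞) (fun y => pd f y i) U :=
  (hf.fderiv_of_isOpen hU (m := (⊤ : ℕ∞)) (by simp)).clm_apply contDiffOn_const

theorem pd2_comm {f : EuclideanSpace ℝ (Fin n) → F} (hf : ContDiffAt ℝ (⊤ : ℕ∞) f x)
    (i j : Fin n) : pd2 f x i j = pd2 f x j i := by
  have hd : DifferentiableAt ℝ (fderiv ℝ f) x :=
    (hf.fderiv_right (m := 1) (by norm_cast)).differentiableAt (by simp)
  have h : ∀ k l : Fin n, pd2 f x k l =
      fderiv ℝ (fderiv ℝ f) x (EuclideanSpace.single l 1) (EuclideanSpace.single k 1) := by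
    intro k l
    simp [pd2, pd, fderiv_clm_apply hd (differentiableAt_const _)]
  rw [h, h]
  exact hf.isSymmSndFDerivAt (by
    rw [minSmoothness_of_isRCLikeNormedField]
    exact WithTop.coe_le_coe.mpr (le_top (α := ℕ∞))) _ _

theorem exists_eq_const_of_pd_eq_zero {f : EuclideanSpace ℝ (Fin n) → F} (hU : IsOpen U)
    (hc : Convex ℝ U) (hf : ∀ x ∈ U, DifferentiableAt ℝ f x)
    (h : ∀ x ∈ U, ∀ i, pd f x i = 0) : ∃ c, ∀ x ∈ U, f x = c := by
  refine hU.exists_is_const_of_fderiv_eq_zero hc.isPreconnected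
    (fun x hx => (hf x hx).differentiableWithinAt) fun x hx => ?_
  refine ContinuousLinearMap.coe_injective
    ((EuclideanSpace.basisFun (Fin n) ℝ).toBasis.ext fun i => ?_)
  simpa [pd] using h x hx i

theorem exists_eq_affine_of_pd_eq_const {f : EuclideanSpace ℝ (Fin n) → F} (hU : IsOpen U)
    (hc : Convex ℝ U) (hf : ∀ x ∈ U, DifferentiableAt ℝ f x) {c : Fin n → F}
    (h : ∀ x ∈ U, ∀ i, pd f x i = c i) : ∃ c₀, ∀ x ∈ U, f x = c₀ + ∑ i, x i • c i := by
  have hd : ∀ x : EuclideanSpace ℝ (Fin n), ∀ k ∈ Finset.univ,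
      DifferentiableAt ℝ (fun y : EuclideanSpace ℝ (Fin n) => y k • c k) x :=
    fun x k _ => (differentiableAt_coord x k).smul_const _
  obtain ⟨c₀, h₀⟩ := exists_eq_const_of_pd_eq_zero (f := fun y => f y - ∑ i, y i • c i) hU hc
    (fun x hx => (hf x hx).sub (DifferentiableAt.fun_sum (hd x))) (by
      intro x hx i
      rw [pd_sub (hf x hx) (DifferentiableAt.fun_sum (hd x)), pd_sum (hd x), h x hx]
      simp [pd_smul_const (differentiableAt_coord x _), pd_coord])
  exact ⟨c₀, fun x hx => sub_eq_iff_eq_add.mp (h₀ x hx)⟩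

theorem exists_eq_spherical_of_pd {p q : Fin n} (hpq : p ≠ q) (hU : IsOpen U)
    (hc : Convex ℝ U) (hcos : ∀ x ∈ U, cos (x p) ≠ 0)
    {W P Q : EuclideanSpace ℝ (Fin n) → F} (hW : ∀ x ∈ U, DifferentiableAt ℝ W x)
    (hP : ∀ x ∈ U, DifferentiableAt ℝ P x) (hQ : ∀ x ∈ U, DifferentiableAt ℝ Q x)
    (hWi : ∀ x ∈ U, ∀ i, i ≠ p → i ≠ q → pd W x i = 0)
    (hPi : ∀ x ∈ U, ∀ i, i ≠ p → i ≠ q → pd P x i = 0)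
    (hQi : ∀ x ∈ U, ∀ i, i ≠ p → i ≠ q → pd Q x i = 0)
    (hWp : ∀ x ∈ U, pd W x p = P x) (hWq : ∀ x ∈ U, pd W x q = Q x)
    (hPp : ∀ x ∈ U, pd P x p = -W x) (hPq : ∀ x ∈ U, pd P x q = -tan (x p) • Q x)
    (hQp : ∀ x ∈ U, pd Q x p = -tan (x p) • Q x)
    (hQq : ∀ x ∈ U, pd Q x q = -cos (x p) ^ 2 • W x + (sin (x p) * cos (x p)) • P x) :
    ∃ A B C : F, ∀ x ∈ U, W x =
      sin (x p) • A + (cos (x p) * sin (x q)) • B + (cos (x p) * cos (x q)) • C := by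
  have hsin' (t : ℝ) : HasDerivAt sin (cos t) t := hasDerivAt_sin t
  have hcos' (t : ℝ) : HasDerivAt cos (-sin t) t := hasDerivAt_cos t
  have hinv {x} (hx : x ∈ U) :
      HasDerivAt (fun t => (cos t)⁻¹) (sin (x p) / cos (x p) ^ 2) (x p) := by
    simpa using (hcos' (x p)).fun_inv (hcos x hx)
  have dsin {x} {g : EuclideanSpace ℝ (Fin n) → F} (j : Fin n) (hg : DifferentiableAt ℝ g x) :=
    differentiableAt_comp_coord_smul (hsin' (x j)) hg
  have dcos {x} {g : EuclideanSpace ℝ (Fin n) → F} (j : Fin n) (hg : DifferentiableAt ℝ g x) :=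
    differentiableAt_comp_coord_smul (hcos' (x j)) hg
  let D := fun y : EuclideanSpace ℝ (Fin n) => cos (y p) • W y - sin (y p) • P y
  let R := fun y : EuclideanSpace ℝ (Fin n) => (cos (y p))⁻¹ • Q y
  have hD : ∀ x ∈ U, DifferentiableAt ℝ D x :=
    fun x hx => (dcos p (hW x hx)).sub (dsin p (hP x hx))
  have hR : ∀ x ∈ U, DifferentiableAt ℝ R x :=
    fun x hx => differentiableAt_comp_coord_smul (hinv hx) (hQ x hx)
  have hDi : ∀ x ∈ U, ∀ i, pd D x i = if q = i then R x else 0 := by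
    intro x hx i
    have := hcos x hx
    simp only [D, R]
    rw [pd_sub (dcos p (hW x hx)) (dsin p (hP x hx)), pd_comp_coord_smul (hcos' _) (hW x hx),
      pd_comp_coord_smul (hsin' _) (hP x hx)]
    by_cases hip : i = p
    · subst hip
      rw [hWp x hx, hPp x hx, if_pos rfl, if_pos rfl, if_neg hpq.symm]
      module
    · by_cases hiq : i = q
      · subst hiq
        rw [hWq x hx, hPq x hx, if_neg hpq, if_neg hpq, if_pos rfl, tan_eq_sin_div_cos,
          zero_smul, zero_smul]
        match_scalars
        field_simp
        linarith [sin_sq_add_cos_sq (x p)]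
      · simp [hWi x hx i hip hiq, hPi x hx i hip hiq, Ne.symm hip, Ne.symm hiq]
  have hRi : ∀ x ∈ U, ∀ i, pd R x i = if q = i then -D x else 0 := by
    intro x hx i
    have := hcos x hx
    simp only [D, R]
    rw [pd_comp_coord_smul (hinv hx) (hQ x hx)]
    by_cases hip : i = p
    · subst hip
      rw [hQp x hx, if_pos rfl, if_neg hpq.symm, tan_eq_sin_div_cos]
      match_scalars
      field_simp
      ring
    · by_cases hiq : i = q
      · subst hiq
        rw [hQq x hx, if_neg hpq, if_pos rfl]
        match_scalars <;> field_simp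
      · simp [hQi x hx i hip hiq, Ne.symm hip, Ne.symm hiq]
  obtain ⟨A, hA⟩ := exists_eq_const_of_pd_eq_zero
    (f := fun y => sin (y p) • W y + cos (y p) • P y) hU hc
    (fun x hx => (dsin p (hW x hx)).add (dcos p (hP x hx))) (by
      intro x hx i
      have := hcos x hx
      rw [pd_add (dsin p (hW x hx)) (dcos p (hP x hx)), pd_comp_coord_smul (hsin' _) (hW x hx),
        pd_comp_coord_smul (hcos' _) (hP x hx)]
      by_cases hip : i = p
      · subst hip
        rw [hWp x hx, hPp x hx, if_pos rfl, if_pos rfl]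
        module
      · by_cases hiq : i = q
        · subst hiq
          rw [hWq x hx, hPq x hx, if_neg hpq, if_neg hpq, tan_eq_sin_div_cos,
            zero_smul, zero_smul]
          match_scalars
          field_simp
          ring
        · simp [hWi x hx i hip hiq, hPi x hx i hip hiq, Ne.symm hip])
  obtain ⟨B, hB⟩ := exists_eq_const_of_pd_eq_zero
    (f := fun y => sin (y q) • D y + cos (y q) • R y) hU hc
    (fun x hx => (dsin q (hD x hx)).add (dcos q (hR x hx))) (by
      intro x hx i
      rw [pd_add (dsin q (hD x hx)) (dcos q (hR x hx)), pd_comp_coord_smul (hsin' _) (hD x hx),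
        pd_comp_coord_smul (hcos' _) (hR x hx), hDi x hx, hRi x hx]
      split_ifs <;> module)
  obtain ⟨C, hC⟩ := exists_eq_const_of_pd_eq_zero
    (f := fun y => cos (y q) • D y - sin (y q) • R y) hU hc
    (fun x hx => (dcos q (hD x hx)).sub (dsin q (hR x hx))) (by
      intro x hx i
      rw [pd_sub (dcos q (hD x hx)) (dsin q (hR x hx)), pd_comp_coord_smul (hcos' _) (hD x hx),
        pd_comp_coord_smul (hsin' _) (hR x hx), hDi x hx, hRi x hx]
      split_ifs <;> module)
  refine ⟨A, B, C, fun x hx => ?_⟩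
  have hDx : D x = sin (x q) • B + cos (x q) • C := by
    rw [← hB x hx, ← hC x hx]
    generalize D x = d, R x = r
    match_scalars <;> linarith [sin_sq_add_cos_sq (x q)]
  have hWx : W x = sin (x p) • A + cos (x p) • D x := by
    rw [← hA x hx]
    simp only [D]
    match_scalars <;> linarith [sin_sq_add_cos_sq (x p)]
  rw [hWx, hDx]
  module

theorem exists_eq_of_pd_system {o p q : Fin n} (hpo : p ≠ o) (hqo : q ≠ o) (hpq : p ≠ q)
    {a b : ℝ} (ha : a ≠ 0) (hab : a ^ 2 + b ^ 2 = 1) (hU : IsOpen U) (hc : Convex ℝ U)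
    (ho : ∀ x ∈ U, x o ≠ 0) (hcos : ∀ x ∈ U, cos (x p) ≠ 0)
    {L ξ : EuclideanSpace ℝ (Fin n) → F} (hL : ContDiffOn ℝ (⊤ : ℕ∞) L U)
    (hξ : ContDiffOn ℝ (⊤ : ℕ∞) ξ U)
    (h1 : ∀ x ∈ U, ∀ i j, i ≠ p → i ≠ q → j ≠ p → j ≠ q → pd2 L x i j = 0)
    (h2 : ∀ x ∈ U, ∀ r, r = p ∨ r = q → pd2 L x r o = (1 / x o) • pd L x r)
    (h3 : ∀ x ∈ U, ∀ k r, k ≠ o → k ≠ p → k ≠ q → r = p ∨ r = q → pd2 L x r k = 0)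
    (h4 : ∀ x ∈ U, pd2 L x p p = (-(a ^ 2) * x o) • pd L x o + (a * b * x o) • ξ x)
    (h5 : ∀ x ∈ U, pd2 L x p q = -tan (x p) • pd L x q)
    (h6 : ∀ x ∈ U, pd2 L x q q = (-(a ^ 2) * x o * cos (x p) ^ 2) • pd L x o +
      (sin (2 * x p) / 2) • pd L x p + (a * b * x o * cos (x p) ^ 2) • ξ x)
    (h7 : ∀ x ∈ U, ∀ j, j ≠ p → j ≠ q → pd ξ x j = 0)
    (h8 : ∀ x ∈ U, ∀ r, r = p ∨ r = q → pd ξ x r = -(b / (a * x o)) • pd L x r) :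
    ∃ (c₀ A B C : F) (c : Fin n → F), c p = 0 ∧ c q = 0 ∧ ∀ x ∈ U,
      L x = c₀ + ∑ i, x i • c i + x o • (sin (x p) • A + (cos (x p) * sin (x q)) • B +
        (cos (x p) * cos (x q)) • C) := by
  have dL : ∀ x ∈ U, DifferentiableAt ℝ L x :=
    fun x hx => (hL.contDiffAt (hU.mem_nhds hx)).differentiableAt (by simp)
  have dξ : ∀ x ∈ U, DifferentiableAt ℝ ξ x :=
    fun x hx => (hξ.contDiffAt (hU.mem_nhds hx)).differentiableAt (by simp)
  have dpd (i : Fin n) : ∀ x ∈ U, DifferentiableAt ℝ (fun y => pd L y i) x := fun x hx =>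
    ((contDiffOn_pd hU hL i).contDiffAt (hU.mem_nhds hx)).differentiableAt (by simp)
  have hsymm : ∀ x ∈ U, ∀ i j, pd2 L x i j = pd2 L x j i :=
    fun x hx i j => pd2_comm (hL.contDiffAt (hU.mem_nhds hx)) i j
  have hinv {x} (hx : x ∈ U) : HasDerivAt (fun t : ℝ => t⁻¹) (-(x o ^ 2)⁻¹) (x o) :=
    hasDerivAt_inv (ho x hx)
  let W := fun y => a ^ 2 • pd L y o - (a * b) • ξ y
  let V := fun r y => (y o)⁻¹ • pd L y r
  have dW : ∀ x ∈ U, DifferentiableAt ℝ W x :=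
    fun x hx => ((dpd o x hx).fun_const_smul _).sub ((dξ x hx).fun_const_smul _)
  have dV (r : Fin n) : ∀ x ∈ U, DifferentiableAt ℝ (V r) x :=
    fun x hx => differentiableAt_comp_coord_smul (hinv hx) (dpd r x hx)
  have hWpd : ∀ x ∈ U, ∀ i, pd W x i = a ^ 2 • pd2 L x o i - (a * b) • pd ξ x i := by
    intro x hx i
    simp only [W]
    rw [pd_sub ((dpd o x hx).fun_const_smul _) ((dξ x hx).fun_const_smul _),
      pd_const_smul _ (dpd o x hx), pd_const_smul _ (dξ x hx), pd2]
  have hVpd (r : Fin n) : ∀ x ∈ U, ∀ i, pd (V r) x i =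
      (x o)⁻¹ • pd2 L x r i + (if o = i then -(x o ^ 2)⁻¹ else 0) • pd L x r :=
    fun x hx i => pd_comp_coord_smul (hinv hx) (dpd r x hx) i
  have hWi : ∀ x ∈ U, ∀ i, i ≠ p → i ≠ q → pd W x i = 0 := by
    intro x hx i hip hiq
    simp [hWpd x hx, h1 x hx o i hpo.symm hqo.symm hip hiq, h7 x hx i hip hiq]
  have hWr : ∀ x ∈ U, ∀ r, r = p ∨ r = q → pd W x r = V r x := by
    intro x hx r hr
    have := ho x hx
    rw [hWpd x hx, hsymm x hx, h2 x hx r hr, h8 x hx r hr]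
    simp only [V]
    match_scalars
    field_simp
    linarith
  have hVi (r : Fin n) (hr : r = p ∨ r = q) :
      ∀ x ∈ U, ∀ i, i ≠ p → i ≠ q → pd (V r) x i = 0 := by
    intro x hx i hip hiq
    have := ho x hx
    rw [hVpd r x hx]
    by_cases hio : i = o
    · subst hio
      rw [h2 x hx r hr, if_pos rfl]
      match_scalars
      field_simp
      ring
    · simp [h3 x hx i r hio hip hiq hr, Ne.symm hio]
  obtain ⟨A, B, C, hABC⟩ := exists_eq_spherical_of_pd hpq hU hc hcos dW (dV p) (dV q) hWi
    (hVi p (.inl rfl)) (hVi q (.inr rfl)) (fun x hx => hWr x hx p (.inl rfl))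
    (fun x hx => hWr x hx q (.inr rfl))
    (fun x hx => by
      have := ho x hx
      rw [hVpd p x hx, h4 x hx, if_neg hpo.symm]
      simp only [W]
      match_scalars <;> field_simp)
    (fun x hx => by
      rw [hVpd p x hx, h5 x hx, if_neg hqo.symm]
      simp only [V]
      module)
    (fun x hx => by
      rw [hVpd q x hx, hsymm x hx, h5 x hx, if_neg hpo.symm]
      simp only [V]
      module)
    (fun x hx => by
      have := ho x hx
      rw [hVpd q x hx, h6 x hx, if_neg hqo.symm, sin_two_mul]
      simp only [W, V]
      match_scalars <;> field_simp)
  let G := fun y : EuclideanSpace ℝ (Fin n) => L y - y o • W y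
  have dG : ∀ x ∈ U, DifferentiableAt ℝ G x :=
    fun x hx => (dL x hx).sub ((differentiableAt_coord x o).fun_smul (dW x hx))
  have hGpd : ∀ x ∈ U, ∀ i,
      pd G x i = pd L x i - (x o • pd W x i + (if o = i then (1 : ℝ) else 0) • W x) := by
    intro x hx i
    simp only [G]
    rw [pd_sub (dL x hx) ((differentiableAt_coord x o).fun_smul (dW x hx)),
      pd_smul (differentiableAt_coord x o) (dW x hx), pd_coord]
  have hGr : ∀ x ∈ U, ∀ r, r = p ∨ r = q → pd G x r = 0 := by
    intro x hx r hr
    have hor : o ≠ r := by rcases hr with rfl | rfl <;> exact Ne.symm ‹_›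
    simp [hGpd x hx, hWr x hx r hr, V, hor, smul_smul, ho x hx]
  have hG : ∀ i, ∃ c, (∀ x ∈ U, pd G x i = c) ∧ (i = p ∨ i = q → c = 0) := by
    intro i
    by_cases hi : i = p ∨ i = q
    · exact ⟨0, fun x hx => hGr x hx i hi, fun _ => rfl⟩
    · push Not at hi
      obtain ⟨c, hc'⟩ := exists_eq_const_of_pd_eq_zero
        (f := fun y => pd L y i - (if o = i then (1 : ℝ) else 0) • W y) hU hc
        (fun x hx => (dpd i x hx).sub ((dW x hx).fun_const_smul _)) (by
          intro x hx j
          rw [pd_sub (dpd i x hx) ((dW x hx).fun_const_smul _), pd_const_smul _ (dW x hx)]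
          change pd2 L x i j - _ = 0
          by_cases hj : j = p ∨ j = q
          · rw [hWr x hx j hj, hsymm x hx]
            by_cases hio : i = o
            · subst hio
              simp [h2 x hx j hj, V]
            · simp [h3 x hx i j hio hi.1 hi.2 hj, Ne.symm hio]
          · push Not at hj
            simp [h1 x hx i j hi.1 hi.2 hj.1 hj.2, hWi x hx j hj.1 hj.2])
      refine ⟨c, fun x hx => ?_, fun h => ?_⟩
      · rw [hGpd x hx, hWi x hx i hi.1 hi.2, smul_zero, zero_add]
        exact hc' x hx
      · simp [hi] at h
  choose c hGc hc0 using hG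
  obtain ⟨c₀, h₀⟩ := exists_eq_affine_of_pd_eq_const hU hc dG fun x hx i => hGc i x hx
  refine ⟨c₀, A, B, C, c, hc0 p (.inl rfl), hc0 q (.inr rfl), fun x hx => ?_⟩
  rw [← hABC x hx, ← h₀ x hx]
  simp [G]

end PartialDerivatives

theorem stmt2 (n : ℕ) (hn : 4 ≤ n) (a : ℝ) (ha0 : 0 < a) (ha1 : a < 1)
    (U : Set (EuclideanSpace ℝ (Fin n)))
    (hU : U = {x | 0 < x ⟨0, by omega⟩ ∧
      -(π / 2) < x ⟨n - 2, by omega⟩ ∧ x ⟨n - 2, by omega⟩ < π / 2})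
    (L ξ : EuclideanSpace ℝ (Fin n) → EuclideanSpace ℝ (Fin (n + 1)))
    (hLsmooth : ContDiffOn ℝ (⊤ : ℕ∞) L U) (hξsmooth : ContDiffOn ℝ (⊤ : ℕ∞) ξ U)
    (h1 : ∀ x ∈ U, ∀ i j : Fin n, (i : ℕ) ≤ n - 3 → (j : ℕ) ≤ n - 3 →
      pd2 L x i j = 0)
    (h2 : ∀ x ∈ U, ∀ r : Fin n, (r : ℕ) = n - 2 ∨ (r : ℕ) = n - 1 →
      pd2 L x r ⟨0, by omega⟩ = (1 / x ⟨0, by omega⟩) • pd L x r)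
    (h3 : ∀ x ∈ U, ∀ k r : Fin n, 1 ≤ (k : ℕ) → (k : ℕ) ≤ n - 3 →
      ((r : ℕ) = n - 2 ∨ (r : ℕ) = n - 1) → pd2 L x r k = 0)
    (h4 : ∀ x ∈ U,
      pd2 L x ⟨n - 2, by omega⟩ ⟨n - 2, by omega⟩ =
        (-(a ^ 2) * x ⟨0, by omega⟩) • pd L x ⟨0, by omega⟩ +
          (a * Real.sqrt (1 - a ^ 2) * x ⟨0, by omega⟩) • ξ x)
    (h5 : ∀ x ∈ U,
      pd2 L x ⟨n - 2, by omega⟩ ⟨n - 1, by omega⟩ =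
        (-Real.tan (x ⟨n - 2, by omega⟩)) • pd L x ⟨n - 1, by omega⟩)
    (h6 : ∀ x ∈ U,
      pd2 L x ⟨n - 1, by omega⟩ ⟨n - 1, by omega⟩ =
        (-(a ^ 2) * x ⟨0, by omega⟩ * Real.cos (x ⟨n - 2, by omega⟩) ^ 2) •
            pd L x ⟨0, by omega⟩ +
          (Real.sin (2 * x ⟨n - 2, by omega⟩) / 2) • pd L x ⟨n - 2, by omega⟩ +
          (a * Real.sqrt (1 - a ^ 2) * x ⟨0, by omega⟩ *
            Real.cos (x ⟨n - 2, by omega⟩) ^ 2) • ξ x)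
    (h7 : ∀ x ∈ U, ∀ j : Fin n, (j : ℕ) ≤ n - 3 → pd ξ x j = 0)
    (h8 : ∀ x ∈ U, ∀ r : Fin n, (r : ℕ) = n - 2 ∨ (r : ℕ) = n - 1 →
      pd ξ x r = (-(Real.sqrt (1 - a ^ 2) / (a * x ⟨0, by omega⟩))) • pd L x r) :
    ∃ c : Fin (n + 2) → EuclideanSpace ℝ (Fin (n + 1)), ∀ x ∈ U,
      L x = c ⟨0, by omega⟩ +
        (∑ i : Fin (n - 2), x (Fin.castLE (by omega) i) •
          c ⟨(i : ℕ) + 1, by have := i.isLt; omega⟩) +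
        x ⟨0, by omega⟩ •
          (Real.sin (x ⟨n - 2, by omega⟩) • c ⟨n - 1, by omega⟩ +
           (Real.cos (x ⟨n - 2, by omega⟩) * Real.sin (x ⟨n - 1, by omega⟩)) •
             c ⟨n, by omega⟩ +
           (Real.cos (x ⟨n - 2, by omega⟩) * Real.cos (x ⟨n - 1, by omega⟩)) •
             c ⟨n + 1, by omega⟩) := by
  have hcont (j : Fin n) : Continuous fun x : EuclideanSpace ℝ (Fin n) => x j :=
    (EuclideanSpace.proj (𝕜 := ℝ) j).continuous
  have hgt (j : Fin n) (r : ℝ) : Convex ℝ {x : EuclideanSpace ℝ (Fin n) | r < x j} :=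
    (convex_Ioi r).linear_preimage (EuclideanSpace.proj (𝕜 := ℝ) j).toLinearMap
  have hlt (j : Fin n) (r : ℝ) : Convex ℝ {x : EuclideanSpace ℝ (Fin n) | x j < r} :=
    (convex_Iio r).linear_preimage (EuclideanSpace.proj (𝕜 := ℝ) j).toLinearMap
  have hUo : IsOpen U := by
    rw [hU]
    exact (isOpen_lt continuous_const (hcont _)).and
      ((isOpen_lt continuous_const (hcont _)).and (isOpen_lt (hcont _) continuous_const))
  have hUc : Convex ℝ U := by
    rw [hU]
    exact (hgt _ _).inter ((hgt _ _).inter (hlt _ _))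
  have hpos : ∀ x ∈ U, 0 < x ⟨0, by omega⟩ := fun x hx => by
    rw [hU] at hx
    exact hx.1
  have hcos : ∀ x ∈ U, 0 < cos (x ⟨n - 2, by omega⟩) := fun x hx => by
    rw [hU] at hx
    exact cos_pos_of_mem_Ioo hx.2
  have hab : a ^ 2 + √(1 - a ^ 2) ^ 2 = 1 := by
    rw [Real.sq_sqrt (by nlinarith)]
    ring
  have hle (i : Fin n) (hp : i ≠ ⟨n - 2, by omega⟩) (hq : i ≠ ⟨n - 1, by omega⟩) :
      (i : ℕ) ≤ n - 3 := by
    simp only [ne_eq, Fin.ext_iff] at hp hq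
    omega
  have hr (r : Fin n) (h : r = ⟨n - 2, by omega⟩ ∨ r = ⟨n - 1, by omega⟩) :
      (r : ℕ) = n - 2 ∨ (r : ℕ) = n - 1 := by
    simpa only [Fin.ext_iff] using h
  obtain ⟨c₀, A, B, C, c, hcp, hcq, h⟩ := exists_eq_of_pd_system (o := ⟨0, by omega⟩)
    (p := ⟨n - 2, by omega⟩) (q := ⟨n - 1, by omega⟩) (by simp; omega) (by simp; omega)
    (by simp; omega) ha0.ne' hab hUo hUc (fun x hx => (hpos x hx).ne')
    (fun x hx => (hcos x hx).ne') hLsmooth hξsmooth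
    (fun x hx i j hi hi' hj hj' => h1 x hx i j (hle i hi hi') (hle j hj hj'))
    (fun x hx r h => h2 x hx r (hr r h))
    (fun x hx k r hk hk' hk'' h => h3 x hx k r
      (Nat.one_le_iff_ne_zero.mpr fun h0 => hk (Fin.ext h0)) (hle k hk' hk'') (hr r h))
    h4 h5 h6 (fun x hx j hj hj' => h7 x hx j (hle j hj hj')) (fun x hx r h => h8 x hx r (hr r h))
  refine ⟨fun k => if (k : ℕ) = 0 then c₀ else if hk : (k : ℕ) ≤ n - 2 then c ⟨k - 1, by omega⟩
    else if (k : ℕ) = n - 1 then A else if (k : ℕ) = n then B else C, fun x hx => ?_⟩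
  have hsum : ∑ i : Fin (n - 2), x (Fin.castLE (by omega) i) • c (Fin.castLE (by omega) i) =
      ∑ i, x i • c i := by
    refine Fintype.sum_of_injective (Fin.castLE (by omega)) (Fin.castLE_injective _) _ _
      (fun i hi => ?_) fun _ => rfl
    have hi' : i = ⟨n - 2, by omega⟩ ∨ i = ⟨n - 1, by omega⟩ := by
      by_contra! hne
      have := hle i hne.1 hne.2
      exact hi ⟨⟨i, by omega⟩, rfl⟩
    rcases hi' with rfl | rfl <;> simp [hcp, hcq]
  rw [h x hx, ← hsum]
  have sub_one_ne : ¬ n - 1 = 0 := by omega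
  have sub_one_not_le : ¬ n - 1 ≤ n - 2 := by omega
  have n_ne_zero : ¬ n = 0 := by omega
  have n_not_le : ¬ n ≤ n - 2 := by omega
  have n_ne_sub_one : ¬ n = n - 1 := by omega
  have succ_not_le : ¬ n + 1 ≤ n - 2 := by omega
  have succ_ne_sub_one : ¬ n + 1 = n - 1 := by omega
  have fin_succ_le (i : Fin (n - 2)) : (i : ℕ) + 1 ≤ n - 2 := i.isLt
  simp only [sub_one_ne, sub_one_not_le, n_ne_zero, n_not_le, n_ne_sub_one, succ_not_le,
    succ_ne_sub_one, fin_succ_le, if_true, if_false, dif_neg, dif_pos, not_false_eq_true,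
    Nat.succ_ne_zero, Nat.succ_ne_self, Nat.add_sub_cancel]
  rfl
end

section
/- Let m ≥ 2 be an integer and let f : (−π/2, π/2)^m → ℝ be a smooth function satisfying: (i) ∂²f/∂x₁² = −f; (ii) ∂²f/∂x_i∂x_j = −tan(x_i) ∂f/∂x_j for all 1 ≤ i < j ≤ m; (iii) ∂²f/∂x_k² = Σ_{j=1}^{k−1} (sin(2x_j)/2)(∏_{i=j+1}^{k−1} cos²x_i) ∂f/∂x_j − f ∏_{j=1}^{k−1} cos²x_j for all 2 ≤ k ≤ m. Then there exist real numbers b₁, …, b_{m+1} such that f(x₁,…,x_m) = b₁ sin x₁ + b₂ sin x₂ cos x₁ + ⋯ + b_m sin x_m ∏_{j=1}^{m−1} cos x_j + b_{m+1} ∏_{j=1}^{m} cos x_j, i.e., f(x) = Σ_{k=1}^{m} b_k sin(x_k) ∏_{j=1}^{k−1} cos x_j + b_{m+1} ∏_{j=1}^{m} cos x_j. -/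
open Real

/-- Solutions of the harmonic oscillator equation on an interval around `0`. -/
lemma eq_cos_add_sin_of_hasDerivAt {φ ψ : ℝ → ℝ} {s : Set ℝ} (hs : IsOpen s)
    (hc : Convex ℝ s) (h0 : (0 : ℝ) ∈ s)
    (hφ : ∀ t ∈ s, HasDerivAt φ (ψ t) t) (hψ : ∀ t ∈ s, HasDerivAt ψ (-φ t) t)
    {t : ℝ} (ht : t ∈ s) : φ t = φ 0 * cos t + ψ 0 * sin t := by
  have hA : ∀ t ∈ s, HasDerivAt (fun t => φ t * cos t - ψ t * sin t) 0 t := fun t ht => by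
    exact (((hφ t ht).mul (hasDerivAt_cos t)).sub
      ((hψ t ht).mul (hasDerivAt_sin t))).congr_deriv (by ring)
  have hB : ∀ t ∈ s, HasDerivAt (fun t => φ t * sin t + ψ t * cos t) 0 t := fun t ht => by
    exact (((hφ t ht).mul (hasDerivAt_sin t)).add
      ((hψ t ht).mul (hasDerivAt_cos t))).congr_deriv (by ring)
  have eA := hs.is_const_of_deriv_eq_zero hc.isPreconnected
    (fun t ht => (hA t ht).differentiableAt.differentiableWithinAt)
    (fun t ht => (hA t ht).deriv) ht h0
  have eB := hs.is_const_of_deriv_eq_zero hc.isPreconnected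
    (fun t ht => (hB t ht).differentiableAt.differentiableWithinAt)
    (fun t ht => (hB t ht).deriv) ht h0
  simp only [cos_zero, sin_zero, mul_one, mul_zero, sub_zero, zero_add] at eA eB
  linear_combination cos t * eA + sin t * eB - φ t * sin_sq_add_cos_sq t

lemma fderiv_apply_eq_sum_pd {n : ℕ} (L : EuclideanSpace ℝ (Fin n) → ℝ)
    (x v : EuclideanSpace ℝ (Fin n)) : fderiv ℝ L x v = ∑ i, v i * pd L x i := by
  conv_lhs => rw [← (EuclideanSpace.basisFun (Fin n) ℝ).sum_repr v]
  simp [pd]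

/-- The open cube `(-π/2, π/2)ⁿ`. -/
def angleCube (n : ℕ) : Set (EuclideanSpace ℝ (Fin n)) :=
  {x | ∀ i, -(π / 2) < x i ∧ x i < π / 2}

lemma isOpen_angleCube (n : ℕ) : IsOpen (angleCube n) := by
  simp only [angleCube, Set.ofPred_forall]
  refine isOpen_iInter_of_finite fun i => ?_
  have hi : Continuous fun x : EuclideanSpace ℝ (Fin n) => x i := by fun_prop
  exact (isOpen_lt continuous_const hi).inter (isOpen_lt hi continuous_const)

lemma smul_mem_angleCube {n : ℕ} {x : EuclideanSpace ℝ (Fin n)} (hx : x ∈ angleCube n)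
    {t : ℝ} (ht : t ∈ Set.Icc (0 : ℝ) 1) : t • x ∈ angleCube n := fun i => by
  obtain ⟨h1, h2⟩ := hx i
  have := pi_pos
  simp only [PiLp.smul_apply, smul_eq_mul]
  obtain ⟨h3, h4⟩ := ht
  constructor <;> nlinarith

/-- Replace the first `k` coordinates by zero. -/
noncomputable def zeroBelow {n : ℕ} (k : ℕ) (x : EuclideanSpace ℝ (Fin n)) :
    EuclideanSpace ℝ (Fin n) :=
  WithLp.toLp 2 fun i => if (i : ℕ) < k then 0 else x i

lemma zeroBelow_apply {n : ℕ} (k : ℕ) (x : EuclideanSpace ℝ (Fin n)) (i : Fin n) :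
    zeroBelow k x i = if (i : ℕ) < k then 0 else x i := rfl

lemma zeroBelow_zero {n : ℕ} (x : EuclideanSpace ℝ (Fin n)) : zeroBelow 0 x = x := by
  ext i; simp [zeroBelow_apply]

lemma zeroBelow_self {n : ℕ} (x : EuclideanSpace ℝ (Fin n)) : zeroBelow n x = 0 := by
  ext i; simp [zeroBelow_apply]

lemma zeroBelow_eq_add_single {n : ℕ} (k : Fin n) (x : EuclideanSpace ℝ (Fin n)) :
    zeroBelow k x = zeroBelow (k + 1) x + x k • EuclideanSpace.single k (1 : ℝ) := by
  ext i
  rcases lt_trichotomy i k with h | rfl | h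
  · have h' : (i : ℕ) < k := h
    simp [zeroBelow_apply, h.ne, h', h'.trans (Nat.lt_succ_self _)]
  · simp [zeroBelow_apply]
  · have h' : (k : ℕ) < i := h
    simp [zeroBelow_apply, h.ne', not_lt.2 h'.le, not_lt.2 (Nat.succ_le_of_lt h')]

lemma zeroBelow_mem_angleCube {n : ℕ} (k : ℕ) {x : EuclideanSpace ℝ (Fin n)}
    (hx : x ∈ angleCube n) : zeroBelow k x ∈ angleCube n := fun i => by
  have := pi_pos
  rw [zeroBelow_apply]
  split_ifs
  · constructor <;> linarith
  · exact hx i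

section

variable {n : ℕ} {f : EuclideanSpace ℝ (Fin n) → ℝ}

lemma differentiableAt_pd (hf : ContDiffOn ℝ (⊤ : ℕ∞) f (angleCube n)) (k : Fin n)
    {y : EuclideanSpace ℝ (Fin n)} (hy : y ∈ angleCube n) :
    DifferentiableAt ℝ (fun y => pd f y k) y := by
  have hd : DifferentiableAt ℝ (fderiv ℝ f) y :=
    ((hf.contDiffAt ((isOpen_angleCube n).mem_nhds hy)).fderiv_right (m := 1)
      (WithTop.coe_le_coe.2 le_top)).differentiableAt one_ne_zero
  exact hd.clm_apply (differentiableAt_const _)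

/-- If `∂ₖ∂ⱼ f` vanishes for `j > k` wherever the `k`-th coordinate does, then `∂ₖ f` is constant
on the subspace where the first `k + 1` coordinates are zero. -/
lemma pd_zeroBelow_succ (hf : ContDiffOn ℝ (⊤ : ℕ∞) f (angleCube n)) (k : Fin n)
    (hk : ∀ y ∈ angleCube n, y k = 0 → ∀ j, k < j → pd2 f y k j = 0)
    {x : EuclideanSpace ℝ (Fin n)} (hx : x ∈ angleCube n) :
    pd f (zeroBelow (k + 1) x) k = pd f 0 k := by
  set z := zeroBelow ((k : ℕ) + 1) x with hz
  have hzU : z ∈ angleCube n := zeroBelow_mem_angleCube _ hx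
  have hder : ∀ t ∈ Set.Icc (0 : ℝ) 1, HasDerivAt (fun t : ℝ => pd f (t • z) k) 0 t := by
    intro t ht
    have hg : HasDerivAt (fun t : ℝ => t • z) z t := by
      simpa using (hasDerivAt_id t).smul_const z
    have hU := smul_mem_angleCube hzU ht
    have := (differentiableAt_pd hf k hU).hasFDerivAt.comp_hasDerivAt t hg
    rw [fderiv_apply_eq_sum_pd, Finset.sum_eq_zero] at this
    · exact this
    intro i _
    by_cases hik : (i : ℕ) < k + 1
    · simp [hz, zeroBelow_apply, hik]
    · have h0 := hk (t • z) hU (by simp [hz, zeroBelow_apply]) i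
        (Fin.lt_def.2 (by omega))
      rw [pd2] at h0
      rw [h0, mul_zero]
  have := constant_of_has_deriv_right_zero
    (fun t ht => (hder t ht).continuousAt.continuousWithinAt)
    (fun t ht => (hder t (Set.Ico_subset_Icc_self ht)).hasDerivWithinAt) 1
    (Set.right_mem_Icc.2 zero_le_one)
  simpa using this

/-- If `∂ₖ² f = -f` wherever the first `k` coordinates vanish, then `f` is a harmonic
oscillation in the `k`-th coordinate there. -/
lemma apply_zeroBelow (hf : ContDiffOn ℝ (⊤ : ℕ∞) f (angleCube n)) (k : Fin n)
    (hk : ∀ y ∈ angleCube n, (∀ j, j < k → y j = 0) → pd2 f y k k = -f y)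
    {x : EuclideanSpace ℝ (Fin n)} (hx : x ∈ angleCube n) :
    f (zeroBelow k x) =
      f (zeroBelow (k + 1) x) * cos (x k) + pd f (zeroBelow (k + 1) x) k * sin (x k) := by
  rw [zeroBelow_eq_add_single]
  set z := zeroBelow ((k : ℕ) + 1) x with hz
  have hzU : z ∈ angleCube n := zeroBelow_mem_angleCube _ hx
  set e : EuclideanSpace ℝ (Fin n) := EuclideanSpace.single k 1 with he
  have hmem : ∀ t ∈ Set.Ioo (-(π / 2)) (π / 2), z + t • e ∈ angleCube n := by
    intro t ht i
    by_cases hik : i = k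
    · subst hik
      simpa [hz, he, zeroBelow_apply] using ht
    · simpa [he, hik] using hzU i
  have hg : ∀ t : ℝ, HasDerivAt (fun t : ℝ => z + t • e) e t := fun t => by
    simpa using ((hasDerivAt_id t).smul_const e).const_add z
  have := eq_cos_add_sin_of_hasDerivAt (φ := fun t => f (z + t • e))
    (ψ := fun t => pd f (z + t • e) k) isOpen_Ioo (convex_Ioo (-(π / 2)) (π / 2))
    (by constructor <;> linarith [pi_pos])
    (fun t ht => ((hf.contDiffAt ((isOpen_angleCube n).mem_nhds
      (hmem t ht))).differentiableAt (by simp)).hasFDerivAt.comp_hasDerivAt t (hg t))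
    (fun t ht => by
      rw [← hk _ (hmem t ht) fun j hj => ?_]
      · exact (differentiableAt_pd hf k (hmem t ht)).hasFDerivAt.comp_hasDerivAt t (hg t)
      · have : (j : ℕ) < k + 1 := Nat.lt_succ_of_lt hj
        simp [hz, he, zeroBelow_apply, hj.ne, this])
    (hx k)
  simpa using this

end

/-- Unrolling the recursion `Fₖ = Fₖ₊₁ cₖ + bₖ sₖ`. -/
lemma eq_sum_add_prod_of_rec {R : Type*} [CommRing R] (F b c s : ℕ → R) (n : ℕ)
    (h : ∀ k < n, F k = F (k + 1) * c k + b k * s k) :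
    F 0 = (∑ k ∈ Finset.range n, b k * s k * ∏ j ∈ Finset.range k, c j) +
      F n * ∏ j ∈ Finset.range n, c j := by
  induction n with
  | zero => simp
  | succ n ih =>
    rw [ih fun k hk => h k (hk.trans n.lt_succ_self), Finset.sum_range_succ,
      Finset.prod_range_succ, h n n.lt_succ_self]
    ring

theorem stmt6 (m : ℕ) (hm : 2 ≤ m)
    (U : Set (EuclideanSpace ℝ (Fin m)))
    (hU : U = {x | ∀ i : Fin m, -(π / 2) < x i ∧ x i < π / 2})
    (f : EuclideanSpace ℝ (Fin m) → ℝ)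
    (hf : ContDiffOn ℝ (⊤ : ℕ∞) f U)
    (h1 : ∀ x ∈ U, pd2 f x ⟨0, by omega⟩ ⟨0, by omega⟩ = -f x)
    (h2 : ∀ x ∈ U, ∀ i j : Fin m, i < j →
      pd2 f x i j = -Real.tan (x i) * pd f x j)
    (h3 : ∀ x ∈ U, ∀ k : Fin m, 1 ≤ (k : ℕ) →
      pd2 f x k k =
        (∑ j : Fin (k : ℕ),
          (Real.sin (2 * x (Fin.castLE k.isLt.le j)) / 2) *
            (∏ i : Fin (k : ℕ), if (j : ℕ) < (i : ℕ) then
              Real.cos (x (Fin.castLE k.isLt.le i)) ^ 2 else 1) *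
            pd f x (Fin.castLE k.isLt.le j)) -
        f x * ∏ j : Fin (k : ℕ), Real.cos (x (Fin.castLE k.isLt.le j)) ^ 2) :
    ∃ b : Fin (m + 1) → ℝ, ∀ x ∈ U,
      f x = (∑ k : Fin m,
          b (Fin.castSucc k) * Real.sin (x k) *
            ∏ j : Fin (k : ℕ), Real.cos (x (Fin.castLE k.isLt.le j))) +
        b (Fin.last m) * ∏ j : Fin m, Real.cos (x j) := by
  change U = angleCube m at hU
  subst hU
  have hsq : ∀ k : Fin m, ∀ y ∈ angleCube m, (∀ j, j < k → y j = 0) → pd2 f y k k = -f y := by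
    intro k y hy h0
    rcases Nat.eq_zero_or_pos (k : ℕ) with hk | hk
    · have hk0 : k = ⟨0, by omega⟩ := Fin.ext hk
      rw [hk0]
      exact h1 y hy
    · have hz : ∀ j : Fin (k : ℕ), y (Fin.castLE k.isLt.le j) = 0 := fun j =>
        h0 _ (Fin.lt_def.2 j.isLt)
      rw [h3 y hy k hk]
      simp [hz]
  have hmix : ∀ k : Fin m, ∀ y ∈ angleCube m, y k = 0 → ∀ j, k < j → pd2 f y k j = 0 :=
    fun k y hy h0 j hj => by simp [h2 y hy k j hj, h0]
  refine ⟨fun k => if h : (k : ℕ) < m then pd f 0 ⟨k, h⟩ else f 0, fun x hx => ?_⟩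
  let X : ℕ → ℝ := fun j => if h : j < m then x ⟨j, h⟩ else 0
  have hX : ∀ j : Fin m, X j = x j := fun j => by simp [X]
  have hXk : ∀ (k : Fin m) (j : Fin (k : ℕ)), x (Fin.castLE k.isLt.le j) = X j := fun k j => by
    rw [← hX]; rfl
  have key := eq_sum_add_prod_of_rec (fun k => f (zeroBelow k x))
    (fun k => if h : k < m then pd f 0 ⟨k, h⟩ else f 0) (fun k => cos (X k))
    (fun k => sin (X k)) m fun k hk => by
      have := apply_zeroBelow hf ⟨k, hk⟩ (hsq _) hx
      rw [pd_zeroBelow_succ hf _ (hmix _) hx] at this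
      simpa [X, hk] using this
  rw [zeroBelow_zero, zeroBelow_self, Finset.sum_range, Finset.prod_range] at key
  rw [key]
  simp [hXk, hX, Finset.prod_range]
end

section
/- Let n ≥ 4 be an integer and a, b real numbers with a² < 1 + b². Let L : ℝⁿ → ℝ^{n+2} be the map with coordinates (writing S = sinh x_{n−2}, C = cosh x_{n−2}, P = ∏_{j=1}^{n−3} cosh x_j): u₁ = (abS + (1+b²)C)P/√(1+b²); u_{k+1} = sinh(x_k)∏_{j=1}^{k−1} cosh x_j for 1 ≤ k ≤ n−3; u_{n−1} = (√(1−a²+b²)/√(1+b²)) S P; u_n = (aS+bC) cos x_{n−1} cos x_n · P; u_{n+1} = (aS+bC) cos x_{n−1} sin x_n · P; u_{n+2} = (aS+bC) sin x_{n−1} · P. Then for every x ∈ ℝⁿ, η(L(x), L(x)) = −1 and the first coordinate u₁(x) is positive; i.e., L maps ℝⁿ into the hyperbolic space H^{n+1}(−1) ⊂ ℝ^{n+2}. -/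
theorem sum_range_sinh_mul_prod_cosh_sq (y : ℕ → ℝ) (m : ℕ) :
    ∑ j ∈ Finset.range m,
        (Real.sinh (y j) * ∏ i ∈ Finset.range j, Real.cosh (y i)) *
          (Real.sinh (y j) * ∏ i ∈ Finset.range j, Real.cosh (y i)) =
      (∏ i ∈ Finset.range m, Real.cosh (y i)) ^ 2 - 1 := by
  induction m with
  | zero => simp
  | succ m ih =>
    rw [Finset.sum_range_succ, ih, Finset.prod_range_succ, mul_pow, Real.cosh_sq (y m)]
    ring

theorem mul_sinh_add_mul_cosh_pos {p q : ℝ} (h : |p| ≤ q) (hq : 0 < q) (t : ℝ) :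
    0 < p * Real.sinh t + q * Real.cosh t := by
  have h₁ : |Real.sinh t| < Real.cosh t :=
    abs_lt_of_sq_lt_sq (by rw [Real.cosh_sq]; linarith) (Real.cosh_pos t).le
  have h₂ : |p * Real.sinh t| < q * Real.cosh t := by
    rw [abs_mul]
    calc |p| * |Real.sinh t| ≤ q * |Real.sinh t| := by gcongr
      _ < q * Real.cosh t := by gcongr
  linarith [neg_abs_le (p * Real.sinh t)]

theorem abs_mul_le_one_add_sq {a b : ℝ} (hab : a ^ 2 < 1 + b ^ 2) : |a * b| ≤ 1 + b ^ 2 := by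
  apply abs_le_of_sq_le_sq _ (by positivity)
  nlinarith [mul_le_mul_of_nonneg_right hab.le (sq_nonneg b), sq_nonneg b]

theorem neg_mul_self_add_eq_neg_one {a b : ℝ} (hab : a ^ 2 < 1 + b ^ 2) (t s r P : ℝ) :
    -((a * b * Real.sinh t + (1 + b ^ 2) * Real.cosh t) * P / √(1 + b ^ 2) *
        ((a * b * Real.sinh t + (1 + b ^ 2) * Real.cosh t) * P / √(1 + b ^ 2))) +
      (P ^ 2 - 1 +
        (√(1 - a ^ 2 + b ^ 2) / √(1 + b ^ 2) * Real.sinh t * P) *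
          (√(1 - a ^ 2 + b ^ 2) / √(1 + b ^ 2) * Real.sinh t * P) +
        ((a * Real.sinh t + b * Real.cosh t) * Real.cos s * Real.cos r * P) *
          ((a * Real.sinh t + b * Real.cosh t) * Real.cos s * Real.cos r * P) +
        ((a * Real.sinh t + b * Real.cosh t) * Real.cos s * Real.sin r * P) *
          ((a * Real.sinh t + b * Real.cosh t) * Real.cos s * Real.sin r * P) +
        ((a * Real.sinh t + b * Real.cosh t) * Real.sin s * P) *
          ((a * Real.sinh t + b * Real.cosh t) * Real.sin s * P)) = -1 := by
  have hB : 0 < 1 + b ^ 2 := by positivity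
  have hr : √(1 + b ^ 2) ^ 2 = 1 + b ^ 2 := Real.sq_sqrt hB.le
  have hq : √(1 - a ^ 2 + b ^ 2) ^ 2 = 1 - a ^ 2 + b ^ 2 := Real.sq_sqrt (by linarith)
  have hC := Real.cosh_sq t
  have hs := Real.sin_sq_add_cos_sq s
  have hrot := Real.sin_sq_add_cos_sq r
  have htime : (a * b * Real.sinh t + (1 + b ^ 2) * Real.cosh t) * P / √(1 + b ^ 2) *
      ((a * b * Real.sinh t + (1 + b ^ 2) * Real.cosh t) * P / √(1 + b ^ 2)) =
      ((a * b * Real.sinh t + (1 + b ^ 2) * Real.cosh t) * P) ^ 2 / (1 + b ^ 2) := by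
    rw [← sq, div_pow, hr]
  have hspace : (√(1 - a ^ 2 + b ^ 2) / √(1 + b ^ 2) * Real.sinh t * P) *
      (√(1 - a ^ 2 + b ^ 2) / √(1 + b ^ 2) * Real.sinh t * P) =
      (1 - a ^ 2 + b ^ 2) * (Real.sinh t * P) ^ 2 / (1 + b ^ 2) := by
    rw [← sq, mul_assoc, mul_pow, div_pow, hr, hq, div_mul_eq_mul_div]
  have hsum : ((a * b * Real.sinh t + (1 + b ^ 2) * Real.cosh t) * P) ^ 2 / (1 + b ^ 2) =
      P ^ 2 + (1 - a ^ 2 + b ^ 2) * (Real.sinh t * P) ^ 2 / (1 + b ^ 2) +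
        ((a * Real.sinh t + b * Real.cosh t) * P) ^ 2 := by
    field_simp
    linear_combination (1 + b ^ 2) * P ^ 2 * hC
  rw [htime, hspace, hsum]
  linear_combination ((a * Real.sinh t + b * Real.cosh t) * P) ^ 2 *
    (hs + Real.cos s ^ 2 * hrot)

theorem prod_cosh_castLE {n : ℕ} (x : EuclideanSpace ℝ (Fin n)) (y : ℕ → ℝ)
    (hy : ∀ i (h : i < n), x ⟨i, h⟩ = y i) (k : ℕ) (h : k ≤ n) :
    ∏ j : Fin k, Real.cosh (x (Fin.castLE h j)) = ∏ j ∈ Finset.range k, Real.cosh (y j) := by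
  rw [Finset.prod_range]
  exact Finset.prod_congr rfl fun j _ => by rw [← hy j (by omega)]; rfl


open Real

/-- The Minkowski (Lorentzian) bilinear form `η(u,v) = -u₁v₁ + Σ_{j≥2} uⱼvⱼ` on `ℝ^{N+1}`. -/
noncomputable def eta {N : ℕ} (u v : EuclideanSpace ℝ (Fin (N + 1))) : ℝ :=
  -(u 0 * v 0) + ∑ j : Fin N, u j.succ * v j.succ

theorem stmt7 (n : ℕ) (hn : 4 ≤ n) (a b : ℝ) (hab : a ^ 2 < 1 + b ^ 2)
    (L : EuclideanSpace ℝ (Fin n) → EuclideanSpace ℝ (Fin (n + 2)))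
    (hL : ∀ (x : EuclideanSpace ℝ (Fin n)) (k : Fin (n + 2)),
      L x k =
        (let S := Real.sinh (x ⟨n - 3, by omega⟩);
         let C := Real.cosh (x ⟨n - 3, by omega⟩);
         let P := ∏ j : Fin (n - 3), Real.cosh (x (Fin.castLE (by omega) j));
         if (k : ℕ) = 0 then
           (a * b * S + (1 + b ^ 2) * C) * P / Real.sqrt (1 + b ^ 2)
         else if h : (k : ℕ) ≤ n - 3 then
           Real.sinh (x ⟨(k : ℕ) - 1, by omega⟩) *
             ∏ j : Fin ((k : ℕ) - 1), Real.cosh (x (Fin.castLE (by omega) j))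
         else if (k : ℕ) = n - 2 then
           Real.sqrt (1 - a ^ 2 + b ^ 2) / Real.sqrt (1 + b ^ 2) * S * P
         else if (k : ℕ) = n - 1 then
           (a * S + b * C) * Real.cos (x ⟨n - 2, by omega⟩) *
             Real.cos (x ⟨n - 1, by omega⟩) * P
         else if (k : ℕ) = n then
           (a * S + b * C) * Real.cos (x ⟨n - 2, by omega⟩) *
             Real.sin (x ⟨n - 1, by omega⟩) * P
         else
           (a * S + b * C) * Real.sin (x ⟨n - 2, by omega⟩) * P)) :
    ∀ x : EuclideanSpace ℝ (Fin n),
      eta (L x) (L x) = -1 ∧ 0 < L x ⟨0, by omega⟩ := by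
  intro x
  obtain ⟨m, rfl⟩ : ∃ m, n = m + 3 := ⟨n - 3, by omega⟩
  obtain ⟨y, hy⟩ : ∃ y : ℕ → ℝ, ∀ i (h : i < m + 3), x ⟨i, h⟩ = y i :=
    ⟨fun i => if h : i < m + 3 then x ⟨i, h⟩ else 0, fun i h => by simp [h]⟩
  replace hL := hL x
  simp only [prod_cosh_castLE x y hy] at hL
  simp only [hy, Nat.add_sub_cancel,
    show m + 3 - 2 = m + 1 by omega, show m + 3 - 1 = m + 2 by omega] at hL
  have hB : 0 < 1 + b ^ 2 := by positivity
  have hP : 0 < ∏ j ∈ Finset.range m, Real.cosh (y j) :=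
    Finset.prod_pos fun j _ => Real.cosh_pos _
  constructor
  · have hhead (j : Fin m) : L x j.castSucc.castSucc.castSucc.castSucc.succ =
        Real.sinh (y j) * ∏ i ∈ Finset.range j, Real.cosh (y i) := by
      rw [hL]
      simp [Nat.succ_le_of_lt j.isLt]
    unfold eta
    simp only [Fin.sum_univ_castSucc, hhead]
    rw [← Finset.sum_range (fun j =>
        (Real.sinh (y j) * ∏ i ∈ Finset.range j, Real.cosh (y i)) *
          (Real.sinh (y j) * ∏ i ∈ Finset.range j, Real.cosh (y i))),
      sum_range_sinh_mul_prod_cosh_sq]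
    simp only [hL]
    simp
    exact neg_mul_self_add_eq_neg_one hab _ _ _ _
  · rw [hL]
    simp only [if_true]
    exact div_pos (mul_pos (mul_sinh_add_mul_cosh_pos (abs_mul_le_one_add_sq hab) hB _) hP)
      (Real.sqrt_pos.2 hB)
end

section
/- Let n ≥ 4 be an integer and a, b real numbers with a² < 1 + b². Let L : ℝⁿ → ℝ^{n+2} be immersion (A): with S = sinh x_{n−2}, C = cosh x_{n−2}, P = ∏_{j=1}^{n−3} cosh x_j, the coordinates are u₁ = (abS + (1+b²)C)P/√(1+b²); u_{k+1} = sinh(x_k)∏_{j=1}^{k−1} cosh x_j for 1 ≤ k ≤ n−3; u_{n−1} = (√(1−a²+b²)/√(1+b²)) S P; and (u_n, u_{n+1}, u_{n+2}) = (aS+bC)P·(cos x_{n−1} cos x_n, cos x_{n−1} sin x_n, sin x_{n−1}). Then for every x ∈ ℝⁿ: η(∂L/∂x_i(x), ∂L/∂x_j(x)) = 0 for i ≠ j; η(∂L/∂x₁, ∂L/∂x₁) = 1; η(∂L/∂x_k, ∂L/∂x_k) = ∏_{j=1}^{k−1} cosh²x_j for 2 ≤ k ≤ n−2; η(∂L/∂x_{n−1},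 ∂L/∂x_{n−1}) = (aS+bC)² P²; and η(∂L/∂x_n, ∂L/∂x_n) = (aS+bC)² P² cos²x_{n−1}. In particular L induces the warped-product metric dx₁² + cosh²x₁ dx₂² + ⋯ + (∏_{j=1}^{n−3} cosh²x_j) dx_{n−2}² + (a sinh x_{n−2} + b cosh x_{n−2})²(∏_{j=1}^{n−3} cosh²x_j)(dx_{n−1}² + cos²x_{n−1} dx_n²) wherever this form is positive definite. -/
open Real

/-- The coordinates of `x`, extended by zero to all natural indices. -/
noncomputable def natCoord {n : ℕ} (x : EuclideanSpace ℝ (Fin n)) (j : ℕ) : ℝ :=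
  if h : j < n then x ⟨j, h⟩ else 0

/-- The product `∏_{j < m} cosh (X j)`. -/
noncomputable def coshProd (X : ℕ → ℝ) (m : ℕ) : ℝ := ∏ j ∈ Finset.range m, Real.cosh (X j)

/-- The derivative of `coshProd · m` at `X` in the direction `u`. -/
noncomputable def coshProdDeriv (X u : ℕ → ℝ) : ℕ → ℝ
  | 0 => 0
  | m + 1 => coshProdDeriv X u m * Real.cosh (X m) + coshProd X m * (Real.sinh (X m) * u m)

lemma natCoord_of_lt {n : ℕ} (x : EuclideanSpace ℝ (Fin n)) {j : ℕ} (h : j < n) :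
    natCoord x j = x ⟨j, h⟩ := dif_pos h

lemma natCoord_add_smul {n : ℕ} (x v : EuclideanSpace ℝ (Fin n)) (t : ℝ) (j : ℕ) :
    natCoord (x + t • v) j = natCoord x j + t * natCoord v j := by
  unfold natCoord
  split_ifs <;> simp

lemma natCoord_single {n : ℕ} (i : Fin n) (j : ℕ) :
    natCoord (EuclideanSpace.single i (1 : ℝ)) j = if j = i then 1 else 0 := by
  unfold natCoord
  split_ifs with h h' h'
  · subst h'
    simp
  · have : (⟨j, h⟩ : Fin n) ≠ i := fun e => h' (by simp [← e])
    simp [this]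
  · exact absurd i.isLt (h' ▸ h)
  · rfl

lemma differentiable_natCoord {n : ℕ} (j : ℕ) :
    Differentiable ℝ (fun x : EuclideanSpace ℝ (Fin n) => natCoord x j) := by
  unfold natCoord
  split_ifs <;> fun_prop

lemma differentiable_coshProd_natCoord {n : ℕ} (m : ℕ) :
    Differentiable ℝ (fun x : EuclideanSpace ℝ (Fin n) => coshProd (natCoord x) m) := by
  induction m with
  | zero => simp [coshProd]
  | succ m ih =>
    have h := ih.fun_mul (differentiable_natCoord (n := n) m).cosh
    simpa only [coshProd, Finset.prod_range_succ] using h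

lemma prod_cosh_fin (X : ℕ → ℝ) (m : ℕ) :
    ∏ j : Fin m, Real.cosh (X j) = coshProd X m :=
  (Finset.prod_range fun j => Real.cosh (X j)).symm

lemma hasDerivAt_line (X u : ℕ → ℝ) (j : ℕ) :
    HasDerivAt (fun t : ℝ => X j + t * u j) (u j) 0 := by
  simpa using ((hasDerivAt_id (0 : ℝ)).mul_const (u j)).const_add (X j)

lemma hasDerivAt_coshProd (X u : ℕ → ℝ) (m : ℕ) :
    HasDerivAt (fun t : ℝ => coshProd (fun j => X j + t * u j) m) (coshProdDeriv X u m) 0 := by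
  induction m with
  | zero => simpa [coshProd, coshProdDeriv] using hasDerivAt_const (0 : ℝ) (1 : ℝ)
  | succ m ih =>
    have h := ih.fun_mul (hasDerivAt_line X u m).cosh
    simpa [coshProd, coshProdDeriv, Finset.prod_range_succ] using h

/-- The polarized identity behind the metric of hyperbolic space in iterated warped coordinates. -/
lemma sum_sinh_mul_coshProd_deriv (X u v : ℕ → ℝ) (N : ℕ) :
    ∑ m ∈ Finset.range N,
        (Real.cosh (X m) * u m * coshProd X m + Real.sinh (X m) * coshProdDeriv X u m) *
          (Real.cosh (X m) * v m * coshProd X m + Real.sinh (X m) * coshProdDeriv X v m) =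
      coshProdDeriv X u N * coshProdDeriv X v N +
        ∑ m ∈ Finset.range N, coshProd X m ^ 2 * (u m * v m) := by
  induction N with
  | zero => simp [coshProdDeriv]
  | succ m ih =>
    rw [Finset.sum_range_succ, Finset.sum_range_succ, ih, coshProdDeriv, coshProdDeriv]
    linear_combination (coshProd X m ^ 2 * (u m * v m) - coshProdDeriv X u m * coshProdDeriv X v m)
      * Real.cosh_sq_sub_sinh_sq (X m)

lemma pd_apply_eq {n m : ℕ} {L : EuclideanSpace ℝ (Fin n) → EuclideanSpace ℝ (Fin m)}
    {x : EuclideanSpace ℝ (Fin n)} (hL : DifferentiableAt ℝ L x) (i : Fin n) (k : Fin m) {d : ℝ}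
    (hd : HasDerivAt (fun t : ℝ => L (x + t • EuclideanSpace.single i 1) k) d 0) :
    pd L x i k = d := by
  refine HasDerivAt.unique ?_ hd
  have hline : HasDerivAt (fun t : ℝ => x + t • EuclideanSpace.single i (1 : ℝ))
      (EuclideanSpace.single i 1) 0 := by
    simpa using ((hasDerivAt_id (0 : ℝ)).smul_const
      (EuclideanSpace.single i (1 : ℝ))).const_add x
  have hL' : HasFDerivAt L (fderiv ℝ L x) (x + (0 : ℝ) • EuclideanSpace.single i (1 : ℝ)) := by
    simpa using hL.hasFDerivAt
  have h := hL'.comp_hasDerivAt (0 : ℝ) hline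
  exact (EuclideanSpace.proj (𝕜 := ℝ) k).hasFDerivAt.comp_hasDerivAt (0 : ℝ) h

/-- The Minkowski product of two tangent vectors in the five coordinates that involve the last
three variables, where `C, S` are hyperbolic and `(c, s)`, `(c', s')` are circular functions of
these variables, and `p, q` are derivatives of the warping factor `P`. -/
lemma minkowski_last_five {a b r w C S c s c' s' : ℝ} (hr : r ^ 2 = 1 + b ^ 2)
    (hw : w ^ 2 = 1 - a ^ 2 + b ^ 2) (hr0 : r ≠ 0) (hC : C ^ 2 - S ^ 2 = 1)
    (hc : s ^ 2 + c ^ 2 = 1) (hc' : s' ^ 2 + c' ^ 2 = 1) (P p q u₁ u₂ u₃ v₁ v₂ v₃ : ℝ) :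
    -((((a * b * (C * u₁) + (1 + b ^ 2) * (S * u₁)) * P +
            (a * b * S + (1 + b ^ 2) * C) * p) / r) *
        (((a * b * (C * v₁) + (1 + b ^ 2) * (S * v₁)) * P +
            (a * b * S + (1 + b ^ 2) * C) * q) / r)) +
      (w / r * (C * u₁) * P + w / r * S * p) * (w / r * (C * v₁) * P + w / r * S * q) +
      ((((a * (C * u₁) + b * (S * u₁)) * c + (a * S + b * C) * (-s * u₂)) * c' +
            (a * S + b * C) * c * (-s' * u₃)) * P + (a * S + b * C) * c * c' * p) *
        ((((a * (C * v₁) + b * (S * v₁)) * c + (a * S + b * C) * (-s * v₂)) * c' +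
            (a * S + b * C) * c * (-s' * v₃)) * P + (a * S + b * C) * c * c' * q) +
      ((((a * (C * u₁) + b * (S * u₁)) * c + (a * S + b * C) * (-s * u₂)) * s' +
            (a * S + b * C) * c * (c' * u₃)) * P + (a * S + b * C) * c * s' * p) *
        ((((a * (C * v₁) + b * (S * v₁)) * c + (a * S + b * C) * (-s * v₂)) * s' +
            (a * S + b * C) * c * (c' * v₃)) * P + (a * S + b * C) * c * s' * q) +
      (((a * (C * u₁) + b * (S * u₁)) * s + (a * S + b * C) * (c * u₂)) * P +
            (a * S + b * C) * s * p) *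
        (((a * (C * v₁) + b * (S * v₁)) * s + (a * S + b * C) * (c * v₂)) * P +
            (a * S + b * C) * s * q) =
      P ^ 2 * (u₁ * v₁ + (a * S + b * C) ^ 2 * (u₂ * v₂ + c ^ 2 * (u₃ * v₃))) - p * q := by
  obtain ⟨B, hB⟩ : ∃ B, B = C * u₁ * P + S * p := ⟨_, rfl⟩
  obtain ⟨G, hG⟩ : ∃ G, G = S * u₁ * P + C * p := ⟨_, rfl⟩
  obtain ⟨B', hB'⟩ : ∃ B', B' = C * v₁ * P + S * q := ⟨_, rfl⟩
  obtain ⟨G', hG'⟩ : ∃ G', G' = S * v₁ * P + C * q := ⟨_, rfl⟩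
  obtain ⟨F, hF⟩ : ∃ F, F = (a * S + b * C) * P := ⟨_, rfl⟩
  have hyp : B * B' - G * G' = P ^ 2 * (u₁ * v₁) - p * q := by
    subst hB hG hB' hG'
    linear_combination (P ^ 2 * (u₁ * v₁) - p * q) * hC
  have boost : -((a * b * B + (1 + b ^ 2) * G) / r * ((a * b * B' + (1 + b ^ 2) * G') / r)) +
      w / r * B * (w / r * B') = B * B' - G * G' - (a * B + b * G) * (a * B' + b * G') := by
    have hb : (1 + b ^ 2) ≠ 0 := hr ▸ pow_ne_zero 2 hr0
    have e : -((a * b * B + (1 + b ^ 2) * G) / r * ((a * b * B' + (1 + b ^ 2) * G') / r)) +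
      w / r * B * (w / r * B') = (-((a * b * B + (1 + b ^ 2) * G) *
        (a * b * B' + (1 + b ^ 2) * G')) + w ^ 2 * (B * B')) / r ^ 2 := by
      field_simp
    rw [e, hr, hw, div_eq_iff hb]
    ring
  have sphere : ∀ K K' : ℝ,
      ((K * c - F * s * u₂) * c' - F * c * s' * u₃) *
          ((K' * c - F * s * v₂) * c' - F * c * s' * v₃) +
        ((K * c - F * s * u₂) * s' + F * c * c' * u₃) *
          ((K' * c - F * s * v₂) * s' + F * c * c' * v₃) +
        (K * s + F * c * u₂) * (K' * s + F * c * v₂) =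
      K * K' + F ^ 2 * (u₂ * v₂ + c ^ 2 * (u₃ * v₃)) := by
    intro K K'
    linear_combination ((K * c - F * s * u₂) * (K' * c - F * s * v₂) +
      F ^ 2 * c ^ 2 * u₃ * v₃) * hc' + (K * K' + F ^ 2 * u₂ * v₂) * hc
  have key := sphere (a * B + b * G) (a * B' + b * G')
  subst hB hG hB' hG' hF
  linear_combination boost + key + hyp

/-- The metric induced by an immersion into Minkowski space, evaluated on coordinate vectors. -/
lemma eta_pd_of_coordinates {N : ℕ} {a b : ℝ} (hab : a ^ 2 < 1 + b ^ 2)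
    {L : EuclideanSpace ℝ (Fin (N + 3)) → EuclideanSpace ℝ (Fin (N + 4 + 1))}
    (h0 : ∀ y, L y 0 = (a * b * Real.sinh (natCoord y N) + (1 + b ^ 2) *
      Real.cosh (natCoord y N)) * coshProd (natCoord y) N / Real.sqrt (1 + b ^ 2))
    (hk : ∀ y, ∀ k : Fin N, L y k.castSucc.castSucc.castSucc.castSucc.succ =
      Real.sinh (natCoord y k) * coshProd (natCoord y) k)
    (h1 : ∀ y, L y (Fin.last N).castSucc.castSucc.castSucc.succ =
      Real.sqrt (1 - a ^ 2 + b ^ 2) / Real.sqrt (1 + b ^ 2) * Real.sinh (natCoord y N) *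
        coshProd (natCoord y) N)
    (h2 : ∀ y, L y (Fin.last (N + 1)).castSucc.castSucc.succ =
      (a * Real.sinh (natCoord y N) + b * Real.cosh (natCoord y N)) *
        Real.cos (natCoord y (N + 1)) * Real.cos (natCoord y (N + 2)) * coshProd (natCoord y) N)
    (h3 : ∀ y, L y (Fin.last (N + 2)).castSucc.succ =
      (a * Real.sinh (natCoord y N) + b * Real.cosh (natCoord y N)) *
        Real.cos (natCoord y (N + 1)) * Real.sin (natCoord y (N + 2)) * coshProd (natCoord y) N)
    (h4 : ∀ y, L y (Fin.last (N + 3)).succ =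
      (a * Real.sinh (natCoord y N) + b * Real.cosh (natCoord y N)) *
        Real.sin (natCoord y (N + 1)) * coshProd (natCoord y) N)
    (x : EuclideanSpace ℝ (Fin (N + 3))) (i j : Fin (N + 3)) :
    eta (pd L x i) (pd L x j) =
      if i = j then
        if (i : ℕ) ≤ N then coshProd (natCoord x) i ^ 2
        else if (i : ℕ) = N + 1 then
          (a * Real.sinh (natCoord x N) + b * Real.cosh (natCoord x N)) ^ 2 *
            coshProd (natCoord x) N ^ 2
        else
          (a * Real.sinh (natCoord x N) + b * Real.cosh (natCoord x N)) ^ 2 *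
            coshProd (natCoord x) N ^ 2 * Real.cos (natCoord x (N + 1)) ^ 2
      else 0 := by
  have hdiff : DifferentiableAt ℝ L x := by
    have hX := differentiable_natCoord (n := N + 3)
    have hP := differentiable_coshProd_natCoord (n := N + 3)
    rw [differentiableAt_euclidean]
    intro k
    refine Fin.cases ?_ (fun k => ?_) k
    · simp only [h0]; fun_prop
    refine Fin.lastCases ?_ (fun k => ?_) k
    · simp only [h4]; fun_prop
    refine Fin.lastCases ?_ (fun k => ?_) k
    · simp only [h3]; fun_prop
    refine Fin.lastCases ?_ (fun k => ?_) k
    · simp only [h2]; fun_prop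
    refine Fin.lastCases ?_ (fun k => ?_) k
    · simp only [h1]; fun_prop
    · simp only [hk]; fun_prop
  set X := natCoord x with hX
  set u : Fin (N + 3) → ℕ → ℝ := fun i => natCoord (EuclideanSpace.single i (1 : ℝ)) with hu
  have hline : ∀ i, ∀ t : ℝ, natCoord (x + t • EuclideanSpace.single i (1 : ℝ)) =
      fun j => X j + t * u i j := fun i t => funext fun j => natCoord_add_smul x _ t j
  have e0 : ∀ i, pd L x i 0 = ((a * b * (Real.cosh (X N) * u i N) + (1 + b ^ 2) *
      (Real.sinh (X N) * u i N)) * coshProd X N + (a * b * Real.sinh (X N) + (1 + b ^ 2) *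
      Real.cosh (X N)) * coshProdDeriv X (u i) N) / Real.sqrt (1 + b ^ 2) := by
    intro i
    refine pd_apply_eq hdiff i _ ?_
    simp only [h0, hline]
    have h := ((((hasDerivAt_line X (u i) N).sinh.const_mul (a * b)).fun_add
      ((hasDerivAt_line X (u i) N).cosh.const_mul (1 + b ^ 2))).fun_mul
      (hasDerivAt_coshProd X (u i) N)).div_const (Real.sqrt (1 + b ^ 2))
    simpa using h
  have ek : ∀ i, ∀ k : Fin N, pd L x i k.castSucc.castSucc.castSucc.castSucc.succ =
      Real.cosh (X k) * u i k * coshProd X k + Real.sinh (X k) * coshProdDeriv X (u i) k := by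
    intro i k
    refine pd_apply_eq hdiff i _ ?_
    simp only [hk, hline]
    simpa using (hasDerivAt_line X (u i) k).sinh.fun_mul (hasDerivAt_coshProd X (u i) k)
  have e1 : ∀ i, pd L x i (Fin.last N).castSucc.castSucc.castSucc.succ =
      Real.sqrt (1 - a ^ 2 + b ^ 2) / Real.sqrt (1 + b ^ 2) * (Real.cosh (X N) * u i N) *
        coshProd X N + Real.sqrt (1 - a ^ 2 + b ^ 2) / Real.sqrt (1 + b ^ 2) *
        Real.sinh (X N) * coshProdDeriv X (u i) N := by
    intro i
    refine pd_apply_eq hdiff i _ ?_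
    simp only [h1, hline]
    simpa using ((hasDerivAt_line X (u i) N).sinh.const_mul
      (Real.sqrt (1 - a ^ 2 + b ^ 2) / Real.sqrt (1 + b ^ 2))).fun_mul
      (hasDerivAt_coshProd X (u i) N)
  have hF : ∀ i, HasDerivAt (fun t : ℝ => a * Real.sinh (X N + t * u i N) +
      b * Real.cosh (X N + t * u i N))
      (a * (Real.cosh (X N) * u i N) + b * (Real.sinh (X N) * u i N)) 0 := by
    intro i
    simpa using ((hasDerivAt_line X (u i) N).sinh.const_mul a).fun_add
      ((hasDerivAt_line X (u i) N).cosh.const_mul b)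
  have e2 : ∀ i, pd L x i (Fin.last (N + 1)).castSucc.castSucc.succ =
      (((a * (Real.cosh (X N) * u i N) + b * (Real.sinh (X N) * u i N)) * Real.cos (X (N + 1)) +
        (a * Real.sinh (X N) + b * Real.cosh (X N)) * (-Real.sin (X (N + 1)) * u i (N + 1))) *
        Real.cos (X (N + 2)) + (a * Real.sinh (X N) + b * Real.cosh (X N)) *
        Real.cos (X (N + 1)) * (-Real.sin (X (N + 2)) * u i (N + 2))) * coshProd X N +
        (a * Real.sinh (X N) + b * Real.cosh (X N)) * Real.cos (X (N + 1)) *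
        Real.cos (X (N + 2)) * coshProdDeriv X (u i) N := by
    intro i
    refine pd_apply_eq hdiff i _ ?_
    simp only [h2, hline]
    have h := (((hF i).fun_mul (hasDerivAt_line X (u i) (N + 1)).cos).fun_mul
      (hasDerivAt_line X (u i) (N + 2)).cos).fun_mul (hasDerivAt_coshProd X (u i) N)
    simpa only [zero_mul, add_zero] using h
  have e3 : ∀ i, pd L x i (Fin.last (N + 2)).castSucc.succ =
      (((a * (Real.cosh (X N) * u i N) + b * (Real.sinh (X N) * u i N)) * Real.cos (X (N + 1)) +
        (a * Real.sinh (X N) + b * Real.cosh (X N)) * (-Real.sin (X (N + 1)) * u i (N + 1))) *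
        Real.sin (X (N + 2)) + (a * Real.sinh (X N) + b * Real.cosh (X N)) *
        Real.cos (X (N + 1)) * (Real.cos (X (N + 2)) * u i (N + 2))) * coshProd X N +
        (a * Real.sinh (X N) + b * Real.cosh (X N)) * Real.cos (X (N + 1)) *
        Real.sin (X (N + 2)) * coshProdDeriv X (u i) N := by
    intro i
    refine pd_apply_eq hdiff i _ ?_
    simp only [h3, hline]
    have h := (((hF i).fun_mul (hasDerivAt_line X (u i) (N + 1)).cos).fun_mul
      (hasDerivAt_line X (u i) (N + 2)).sin).fun_mul (hasDerivAt_coshProd X (u i) N)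
    simpa only [zero_mul, add_zero] using h
  have e4 : ∀ i, pd L x i (Fin.last (N + 3)).succ =
      ((a * (Real.cosh (X N) * u i N) + b * (Real.sinh (X N) * u i N)) * Real.sin (X (N + 1)) +
        (a * Real.sinh (X N) + b * Real.cosh (X N)) * (Real.cos (X (N + 1)) * u i (N + 1))) *
        coshProd X N + (a * Real.sinh (X N) + b * Real.cosh (X N)) *
        Real.sin (X (N + 1)) * coshProdDeriv X (u i) N := by
    intro i
    refine pd_apply_eq hdiff i _ ?_
    simp only [h4, hline]
    have h := ((hF i).fun_mul (hasDerivAt_line X (u i) (N + 1)).sin).fun_mul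
      (hasDerivAt_coshProd X (u i) N)
    simpa only [zero_mul, add_zero] using h
  have hb : 0 < 1 + b ^ 2 := by positivity
  have hfive := minkowski_last_five (Real.sq_sqrt hb.le)
    (Real.sq_sqrt (by linarith : 0 ≤ 1 - a ^ 2 + b ^ 2)) (Real.sqrt_pos.2 hb).ne'
    (Real.cosh_sq_sub_sinh_sq (X N)) (Real.sin_sq_add_cos_sq (X (N + 1)))
    (Real.sin_sq_add_cos_sq (X (N + 2))) (coshProd X N) (coshProdDeriv X (u i) N)
    (coshProdDeriv X (u j) N) (u i N) (u i (N + 1)) (u i (N + 2))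
    (u j N) (u j (N + 1)) (u j (N + 2))
  have hsum := sum_sinh_mul_coshProd_deriv X (u i) (u j) N
  have metric : eta (pd L x i) (pd L x j) =
      ∑ m ∈ Finset.range (N + 1), coshProd X m ^ 2 * (u i m * u j m) +
        coshProd X N ^ 2 * (a * Real.sinh (X N) + b * Real.cosh (X N)) ^ 2 *
          (u i (N + 1) * u j (N + 1) +
            Real.cos (X (N + 1)) ^ 2 * (u i (N + 2) * u j (N + 2))) := by
    rw [Finset.sum_range] at hsum
    rw [eta, Fin.sum_univ_castSucc, Fin.sum_univ_castSucc, Fin.sum_univ_castSucc,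
      Fin.sum_univ_castSucc]
    simp only [e0, ek, e1, e2, e3, e4]
    rw [hsum, Finset.sum_range_succ]
    linear_combination hfive
  have hmul : ∀ m : ℕ, u i m * u j m = if i = j ∧ m = i then 1 else 0 := by
    intro m
    simp only [hu, natCoord_single, Fin.ext_iff]
    split_ifs <;> first | omega | simp
  rw [metric]
  simp only [hmul]
  by_cases hij : i = j
  · subst hij
    simp only [true_and, if_true, mul_ite, mul_one, mul_zero, Finset.sum_ite_eq',
      Finset.mem_range]
    have := i.isLt
    split_ifs <;> first | omega | ring
  · simp [hij]

theorem stmt8 (n : ℕ) (hn : 4 ≤ n) (a b : ℝ) (hab : a ^ 2 < 1 + b ^ 2)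
    (L : EuclideanSpace ℝ (Fin n) → EuclideanSpace ℝ (Fin (n + 2)))
    (hL : ∀ (x : EuclideanSpace ℝ (Fin n)) (k : Fin (n + 2)),
      L x k =
        (let S := Real.sinh (x ⟨n - 3, by omega⟩);
         let C := Real.cosh (x ⟨n - 3, by omega⟩);
         let P := ∏ j : Fin (n - 3), Real.cosh (x (Fin.castLE (by omega) j));
         if (k : ℕ) = 0 then
           (a * b * S + (1 + b ^ 2) * C) * P / Real.sqrt (1 + b ^ 2)
         else if h : (k : ℕ) ≤ n - 3 then
           Real.sinh (x ⟨(k : ℕ) - 1, by omega⟩) *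
             ∏ j : Fin ((k : ℕ) - 1), Real.cosh (x (Fin.castLE (by omega) j))
         else if (k : ℕ) = n - 2 then
           Real.sqrt (1 - a ^ 2 + b ^ 2) / Real.sqrt (1 + b ^ 2) * S * P
         else if (k : ℕ) = n - 1 then
           (a * S + b * C) * Real.cos (x ⟨n - 2, by omega⟩) *
             Real.cos (x ⟨n - 1, by omega⟩) * P
         else if (k : ℕ) = n then
           (a * S + b * C) * Real.cos (x ⟨n - 2, by omega⟩) *
             Real.sin (x ⟨n - 1, by omega⟩) * P
         else
           (a * S + b * C) * Real.sin (x ⟨n - 2, by omega⟩) * P)) :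
    ∀ x : EuclideanSpace ℝ (Fin n),
      (∀ i j : Fin n, i ≠ j → eta (pd L x i) (pd L x j) = 0) ∧
      eta (pd L x ⟨0, by omega⟩) (pd L x ⟨0, by omega⟩) = 1 ∧
      (∀ i : Fin n, 1 ≤ (i : ℕ) → (i : ℕ) ≤ n - 3 →
        eta (pd L x i) (pd L x i) =
          ∏ j : Fin (i : ℕ), Real.cosh (x (Fin.castLE i.isLt.le j)) ^ 2) ∧
      eta (pd L x ⟨n - 2, by omega⟩) (pd L x ⟨n - 2, by omega⟩) =
        (a * Real.sinh (x ⟨n - 3, by omega⟩) + b * Real.cosh (x ⟨n - 3, by omega⟩)) ^ 2 *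
          (∏ j : Fin (n - 3), Real.cosh (x (Fin.castLE (by omega) j))) ^ 2 ∧
      eta (pd L x ⟨n - 1, by omega⟩) (pd L x ⟨n - 1, by omega⟩) =
        (a * Real.sinh (x ⟨n - 3, by omega⟩) + b * Real.cosh (x ⟨n - 3, by omega⟩)) ^ 2 *
          (∏ j : Fin (n - 3), Real.cosh (x (Fin.castLE (by omega) j))) ^ 2 *
          Real.cos (x ⟨n - 2, by omega⟩) ^ 2 := by
  obtain ⟨N, rfl⟩ : ∃ N, n = N + 3 := ⟨n - 3, by omega⟩
  have hc : ∀ (y : EuclideanSpace ℝ (Fin (N + 3))) (j : ℕ) (h : j < N + 3),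
      y ⟨j, h⟩ = natCoord y j := fun y j h => (natCoord_of_lt y h).symm
  simp only [hc, Fin.val_castLE, prod_cosh_fin] at hL
  have n3 : N + 3 - 3 = N := by omega
  have n2 : N + 3 - 2 = N + 1 := by omega
  have n1 : N + 3 - 1 = N + 2 := by omega
  simp only [n3, n2, n1] at hL
  have key := eta_pd_of_coordinates (N := N) hab (L := L)
    (fun y => by rw [hL]; simp)
    (fun y k => by rw [hL]; simp)
    (fun y => by rw [hL]; simp)
    (fun y => by rw [hL]; simp)
    (fun y => by rw [hL]; simp)
    (fun y => by rw [hL]; simp)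
  intro x
  refine ⟨fun i j hij => ?_, ?_, fun i _ hi => ?_, ?_, ?_⟩
  · rw [key, if_neg hij]
  · rw [key]
    simp [coshProd]
  · rw [key, if_pos rfl, if_pos (by omega), Finset.prod_pow]
    simp only [hc, Fin.val_castLE, prod_cosh_fin]
  · rw [key]
    simp [prod_cosh_fin, hc, n3, n2]
  · rw [key]
    simp [prod_cosh_fin, hc, n3, n2, n1]
end

section
/- Let n ≥ 4 be an integer and a, b real numbers with a² < b². Let L : ℝⁿ → ℝ^{n+2} be the map with coordinates (writing S = sinh x_{n−2}, C = cosh x_{n−2}, P = ∏_{j=1}^{n−3} cosh x_j, ρ = x_{n−1}² + x_n²): u₁ = [a(b⁴ − 4 + 4b²ρ)S + b(b⁴ + 4 + 4b²ρ)C]·P/(4b³); u₂ = [a(b⁴ + 4 − 4b²ρ)S + b(b⁴ − 4 − 4b²ρ)C]·P/(4b³); u_{k+2} = sinh(x_k)∏_{j=1}^{k−1} cosh x_j for 1 ≤ k ≤ n−3; u_n = (√(b²−a²)/b) S P; u_{n+1} = (aS+bC) x_{n−1} P; u_{n+2} = (aS+bC) x_n P. Then η(L(x), L(x)) = −1 for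 every x ∈ ℝⁿ; i.e., L maps ℝⁿ into the quadric {u ∈ ℝ^{n+2} : η(u,u) = −1}. -/
open Real

/-- The squares of the `sinh` coordinates of the hyperbolic polar parametrization telescope. -/
lemma sum_sq_sinh_mul_prod_cosh (m : ℕ) (y : Fin m → ℝ) :
    ∑ i : Fin m, (sinh (y i) * ∏ j : Fin (i : ℕ), cosh (y (Fin.castLE i.2.le j))) ^ 2 =
      (∏ j : Fin m, cosh (y j)) ^ 2 - 1 := by
  induction m with
  | zero => simp
  | succ m ih =>
    rw [Fin.sum_univ_castSucc, Fin.prod_univ_castSucc]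
    have h := ih fun i => y i.castSucc
    have hlast : ∏ j : Fin ((Fin.last m : Fin (m + 1)) : ℕ),
        cosh (y (Fin.castLE (Fin.last m).2.le j)) =
        ∏ j : Fin m, cosh (y j.castSucc) := rfl
    have hsum : ∑ i : Fin m, (sinh (y i.castSucc) * ∏ j : Fin (i.castSucc : ℕ),
        cosh (y (Fin.castLE i.castSucc.2.le j))) ^ 2 =
        (∏ j : Fin m, cosh (y j.castSucc)) ^ 2 - 1 := h
    rw [hsum, hlast, mul_pow, mul_pow, Real.cosh_sq (y (Fin.last m))]
    ring

/-- The five coordinates carrying the factor `P` contribute `-P ^ 2` to the Minkowski form. -/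
lemma lorentz_identity {a b S C P p q r : ℝ} (hb : b ≠ 0) (hSC : C ^ 2 = S ^ 2 + 1)
    (hr : r ^ 2 = b ^ 2 - a ^ 2) :
    -((a * (b ^ 4 - 4 + 4 * b ^ 2 * (p ^ 2 + q ^ 2)) * S +
          b * (b ^ 4 + 4 + 4 * b ^ 2 * (p ^ 2 + q ^ 2)) * C) * P / (4 * b ^ 3)) ^ 2 +
      ((a * (b ^ 4 + 4 - 4 * b ^ 2 * (p ^ 2 + q ^ 2)) * S +
          b * (b ^ 4 - 4 - 4 * b ^ 2 * (p ^ 2 + q ^ 2)) * C) * P / (4 * b ^ 3)) ^ 2 +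
      (r / b * S * P) ^ 2 + ((a * S + b * C) * p * P) ^ 2 + ((a * S + b * C) * q * P) ^ 2 =
      -P ^ 2 := by
  field_simp
  linear_combination 16 * b ^ 4 * S ^ 2 * P ^ 2 * hr - 16 * b ^ 6 * P ^ 2 * hSC

theorem stmt9 (n : ℕ) (hn : 4 ≤ n) (a b : ℝ) (hab : a ^ 2 < b ^ 2)
    (L : EuclideanSpace ℝ (Fin n) → EuclideanSpace ℝ (Fin (n + 2)))
    (hL : ∀ (x : EuclideanSpace ℝ (Fin n)) (k : Fin (n + 2)),
      L x k =
        (let S := Real.sinh (x ⟨n - 3, by omega⟩);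
         let C := Real.cosh (x ⟨n - 3, by omega⟩);
         let P := ∏ j : Fin (n - 3), Real.cosh (x (Fin.castLE (by omega) j));
         let ρ := x ⟨n - 2, by omega⟩ ^ 2 + x ⟨n - 1, by omega⟩ ^ 2;
         if (k : ℕ) = 0 then
           (a * (b ^ 4 - 4 + 4 * b ^ 2 * ρ) * S + b * (b ^ 4 + 4 + 4 * b ^ 2 * ρ) * C) *
             P / (4 * b ^ 3)
         else if (k : ℕ) = 1 then
           (a * (b ^ 4 + 4 - 4 * b ^ 2 * ρ) * S + b * (b ^ 4 - 4 - 4 * b ^ 2 * ρ) * C) *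
             P / (4 * b ^ 3)
         else if h : (k : ℕ) ≤ n - 2 then
           Real.sinh (x ⟨(k : ℕ) - 2, by omega⟩) *
             ∏ j : Fin ((k : ℕ) - 2), Real.cosh (x (Fin.castLE (by omega) j))
         else if (k : ℕ) = n - 1 then
           Real.sqrt (b ^ 2 - a ^ 2) / b * S * P
         else if (k : ℕ) = n then
           (a * S + b * C) * x ⟨n - 2, by omega⟩ * P
         else
           (a * S + b * C) * x ⟨n - 1, by omega⟩ * P)) :
    ∀ x : EuclideanSpace ℝ (Fin n), eta (L x) (L x) = -1 := by
  intro x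
  obtain ⟨m, rfl⟩ : ∃ m, n = m + 3 := ⟨n - 3, by omega⟩
  have hb : b ≠ 0 := by
    rintro rfl
    nlinarith [sq_nonneg a]
  have hid := lorentz_identity
    (P := ∏ j : Fin (m + 3 - 3), Real.cosh (x (Fin.castLE (by omega) j)))
    (p := x ⟨m + 1, by omega⟩) (q := x ⟨m + 2, by omega⟩) hb
    (Real.cosh_sq (x ⟨m, by omega⟩)) (Real.sq_sqrt (sub_nonneg.2 hab.le))
  have hsum : ∑ i : Fin m, (Real.sinh (x (Fin.castLE (by omega) i)) *
        ∏ j : Fin (i : ℕ), Real.cosh (x (Fin.castLE (by omega) j))) ^ 2 =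
      (∏ j : Fin (m + 3 - 3), Real.cosh (x (Fin.castLE (by omega) j))) ^ 2 - 1 :=
    sum_sq_sinh_mul_prod_cosh m fun j => x (Fin.castLE (by omega) j)
  have h0 := hL x 0
  have h1 := hL x (Fin.succ 0)
  have hmid (i : Fin m) : L x i.castSucc.castSucc.castSucc.succ.succ =
      Real.sinh (x (Fin.castLE (by omega) i)) *
        ∏ j : Fin (i : ℕ), Real.cosh (x (Fin.castLE (by omega) j)) := by
    rw [hL]
    simp
    rfl
  have hA := hL x (Fin.last m).castSucc.castSucc.succ.succ
  have hB := hL x (Fin.last (m + 1)).castSucc.succ.succ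
  have hC := hL x (Fin.last (m + 2)).succ.succ
  simp at h0 h1 hA hB hC
  unfold eta
  rw [Fin.sum_univ_succ, Fin.sum_univ_castSucc, Fin.sum_univ_castSucc, Fin.sum_univ_castSucc]
  simp only [hmid, ← sq]
  rw [show L x (Fin.succ 0) = _ from h1, show L x (Fin.last (m + 2)).succ.succ = _ from hC,
    h0, hA, hB, hsum]
  linear_combination hid
end
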